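/- For integers α, β ≥ 2, the number of non-backtracking paths of length 2n in Γ_{α,β} starting at a fixed vertex, making n upward and n downward steps, is at most C·n·(√(αβ) + √((α−1)(β−1)))^{2n} for some constant C independent of n. Consequently lim sup_n a_{2n}^{1/(2n)} ≤ √(αβ) + √((α−1)(β−1)), where a_m counts simple loops of length m through a fixed vertex. -/

import Mathlib

open Filter

/-- A tree with a distinguished end, encoded by the parent map and a level function. -/
structure OrientedTree (V : Type*) where
  parent : V → V
  level : V → ℤ
  level_parent : ∀ v, level (parent v) = level v - 1

/-- Adjacency in the Diestel-Leader graph: coordinates move along tree edges oriented in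
opposite directions. -/
def DLAdj {V₁ V₂ : Type*} (T₁ : OrientedTree V₁) (T₂ : OrientedTree V₂)
    (x y : V₁ × V₂) : Prop :=
  (T₁.parent y.1 = x.1 ∧ T₂.parent x.2 = y.2) ∨
  (T₁.parent x.1 = y.1 ∧ T₂.parent y.2 = x.2)

/-- Number of non-backtracking paths of length `2n` in the Diestel-Leader graph starting
at `o` and ending at the starting level (hence making `n` upward and `n` downward steps,
as every edge changes the level by `±1`). -/
noncomputable def nbCount {V₁ V₂ : Type*} (T₁ : OrientedTree V₁) (T₂ : OrientedTree V₂)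
    (o : V₁ × V₂) (n : ℕ) : ℕ :=
  Nat.card {w : Fin (2 * n + 1) → V₁ × V₂ //
    w 0 = o ∧ T₁.level (w (Fin.last (2 * n))).1 = T₁.level o.1 ∧
    (∀ i : Fin (2 * n), DLAdj T₁ T₂ (w i.castSucc) (w i.succ)) ∧
    (∀ i j : Fin (2 * n + 1), (i : ℕ) + 2 = (j : ℕ) → w i ≠ w j)}

/-- Number of simple loops of length `m` in the Diestel-Leader graph through `o`. -/
noncomputable def loopCount {V₁ V₂ : Type*} (T₁ : OrientedTree V₁) (T₂ : OrientedTree V₂)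
    (o : V₁ × V₂) (m : ℕ) : ℕ :=
  Nat.card {w : Fin (m + 1) → V₁ × V₂ //
    w 0 = o ∧ w (Fin.last m) = o ∧
    (∀ i : Fin m, DLAdj T₁ T₂ (w i.castSucc) (w i.succ)) ∧
    (∀ i j : Fin m, w i.castSucc = w j.castSucc → i = j)}

/-- Non-backtracking paths from `x`, not stepping first to `p`, ending at level `l`. -/
def NBset {V₁ V₂ : Type*} (T₁ : OrientedTree V₁) (T₂ : OrientedTree V₂)
    (m : ℕ) (p x : V₁ × V₂) (l : ℤ) : Set (Fin (m + 1) → V₁ × V₂) :=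
  {w | w 0 = x ∧ T₁.level (w (Fin.last m)).1 = l ∧
    (∀ i : Fin m, DLAdj T₁ T₂ (w i.castSucc) (w i.succ)) ∧
    (∀ i j : Fin (m + 1), (i : ℕ) + 2 = (j : ℕ) → w i ≠ w j) ∧
    (∀ i : Fin (m + 1), (i : ℕ) = 1 → w i ≠ p)}

lemma NBset_step {V₁ V₂ : Type*} (T₁ : OrientedTree V₁) (T₂ : OrientedTree V₂)
    (m : ℕ) (p x : V₁ × V₂) (l : ℤ) (A : Finset V₁) (B : Finset V₂)
    (hA : ∀ a, T₁.parent a = x.1 → (a, T₂.parent x.2) ≠ p → a ∈ A)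
    (hB : ∀ b, T₂.parent b = x.2 → (T₁.parent x.1, b) ≠ p → b ∈ B) :
    NBset T₁ T₂ (m + 1) p x l ⊆
      (⋃ a ∈ A, (fun w : Fin (m + 1) → V₁ × V₂ => (Fin.cons x w : Fin (m + 1 + 1) → V₁ × V₂)) ''
          NBset T₁ T₂ m x (a, T₂.parent x.2) l) ∪
      (⋃ b ∈ B, (fun w : Fin (m + 1) → V₁ × V₂ => (Fin.cons x w : Fin (m + 1 + 1) → V₁ × V₂)) ''
          NBset T₁ T₂ m x (T₁.parent x.1, b) l) := by
  rintro w ⟨h0, hl, hadj, hnb, hp⟩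
  have htail : ∀ y, w 1 = y → Fin.tail w ∈ NBset T₁ T₂ m x y l := by
    intro y hy
    refine ⟨by simpa [Fin.tail] using hy, ?_, ?_, ?_, ?_⟩
    · simpa [Fin.tail] using hl
    · intro i
      have := hadj i.succ
      simpa [Fin.tail] using this
    · intro i j hij
      apply hnb i.succ j.succ
      simp; omega
    · intro i hi
      rw [← h0]
      apply (hnb 0 i.succ _).symm
      simp; omega
  have hcons : (Fin.cons x (Fin.tail w) : Fin (m + 1 + 1) → V₁ × V₂) = w := by
    rw [← h0]; exact Fin.cons_self_tail w
  have h1 : w 1 ≠ p := hp 1 (by simp)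
  have ha := hadj 0
  simp only [Fin.castSucc_zero, Fin.succ_zero_eq_one, h0] at ha
  rcases ha with ⟨e1, e2⟩ | ⟨e1, e2⟩
  · left
    have hw : w 1 = ((w 1).1, T₂.parent x.2) := by rw [e2]
    simp only [Set.mem_iUnion]
    exact ⟨(w 1).1, hA _ e1 (hw ▸ h1), _, htail _ hw, hcons⟩
  · right
    have hw : w 1 = (T₁.parent x.1, (w 1).2) := by rw [e1]
    simp only [Set.mem_iUnion]
    exact ⟨(w 1).2, hB _ e2 (hw ▸ h1), _, htail _ hw, hcons⟩

lemma ncard_biUnion_image_le {ι X Y : Type*} (A : Finset ι) (f : X → Y) (S : ι → Set X) (b : ℝ)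
    (h : ∀ a ∈ A, (S a).Finite ∧ ((S a).ncard : ℝ) ≤ b) :
    (⋃ a ∈ A, f '' S a).Finite ∧ ((⋃ a ∈ A, f '' S a).ncard : ℝ) ≤ A.card * b := by
  classical
  induction A using Finset.induction_on with
  | empty => simp
  | insert a A ha ih =>
    obtain ⟨i1, i2⟩ := ih (fun a' h' => h a' (Finset.mem_insert_of_mem h'))
    obtain ⟨j1, j2⟩ := h a (Finset.mem_insert_self _ _)
    rw [Finset.set_biUnion_insert, Finset.card_insert_of_notMem ha]
    refine ⟨(j1.image f).union i1, ?_⟩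
    have k1 : ((f '' S a ∪ ⋃ x ∈ A, f '' S x).ncard : ℝ) ≤
        (f '' S a).ncard + (⋃ x ∈ A, f '' S x).ncard := by
      exact_mod_cast Set.ncard_union_le _ _
    have k2 : ((f '' S a).ncard : ℝ) ≤ (S a).ncard := by
      exact_mod_cast Set.ncard_image_le j1
    push_cast
    linarith

lemma NBset_step_card {V₁ V₂ : Type*} (T₁ : OrientedTree V₁) (T₂ : OrientedTree V₂)
    (m : ℕ) (p x : V₁ × V₂) (l : ℤ) (A : Finset V₁) (B : Finset V₂)
    (hA : ∀ a, T₁.parent a = x.1 → (a, T₂.parent x.2) ≠ p → a ∈ A)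
    (hB : ∀ b, T₂.parent b = x.2 → (T₁.parent x.1, b) ≠ p → b ∈ B) (u d : ℝ)
    (hu : ∀ a ∈ A, (NBset T₁ T₂ m x (a, T₂.parent x.2) l).Finite ∧
      ((NBset T₁ T₂ m x (a, T₂.parent x.2) l).ncard : ℝ) ≤ u)
    (hd : ∀ b ∈ B, (NBset T₁ T₂ m x (T₁.parent x.1, b) l).Finite ∧
      ((NBset T₁ T₂ m x (T₁.parent x.1, b) l).ncard : ℝ) ≤ d) :
    (NBset T₁ T₂ (m + 1) p x l).Finite ∧
      ((NBset T₁ T₂ (m + 1) p x l).ncard : ℝ) ≤ A.card * u + B.card * d := by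
  have hs := NBset_step T₁ T₂ m p x l A B hA hB
  obtain ⟨i1, i2⟩ := ncard_biUnion_image_le A
    (fun w : Fin (m + 1) → V₁ × V₂ => (Fin.cons x w : Fin (m + 1 + 1) → V₁ × V₂)) _ u hu
  obtain ⟨j1, j2⟩ := ncard_biUnion_image_le B
    (fun w : Fin (m + 1) → V₁ × V₂ => (Fin.cons x w : Fin (m + 1 + 1) → V₁ × V₂)) _ d hd
  refine ⟨(i1.union j1).subset hs, ?_⟩
  have k1 := (Set.ncard_le_ncard hs (i1.union j1)).trans (Set.ncard_union_le _ _)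
  have k2 : ((NBset T₁ T₂ (m + 1) p x l).ncard : ℝ) ≤ _ := Nat.cast_le.mpr k1
  push_cast at k2
  linarith

lemma fiber_finset {V : Type*} (f : V → V) (α : ℕ) (hα : 2 ≤ α)
    (h : ∀ v, Nat.card {w : V // f w = v} = α) (v : V) :
    ∃ A : Finset V, A.card = α ∧ ∀ a, a ∈ A ↔ f a = v := by
  have hf : Finite {w : V // f w = v} := Nat.finite_of_card_ne_zero (by rw [h]; omega)
  have hf' : {w : V | f w = v}.Finite := hf
  refine ⟨hf'.toFinset, ?_, by simp⟩
  rw [← Set.ncard_eq_toFinset_card _ hf', ← h v]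
  rfl

lemma NBset_bound {V₁ V₂ : Type*} (T₁ : OrientedTree V₁) (T₂ : OrientedTree V₂) (α β : ℕ)
    (hα : 2 ≤ α) (hβ : 2 ≤ β)
    (hreg₁ : ∀ v : V₁, Nat.card {w : V₁ // T₁.parent w = v} = α)
    (hreg₂ : ∀ v : V₂, Nat.card {w : V₂ // T₂.parent w = v} = β)
    (t lam hU hD K : ℝ) (ht : 0 < t) (hK : 0 < K) (hlam : 0 < lam) (hKU : 1 ≤ K * hU)
    (hKD : 1 ≤ K * hD)
    (e1 : lam * hU = α * t * hU + (β - 1) / t * hD)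
    (e2 : lam * hD = (α - 1) * t * hU + β / t * hD) (l : ℤ) (m : ℕ) :
    ∀ p x : V₁ × V₂,
      (T₁.parent x.1 = p.1 → T₂.parent p.2 = x.2 → (NBset T₁ T₂ m p x l).Finite ∧
        ((NBset T₁ T₂ m p x l).ncard : ℝ) ≤ K * hU * lam ^ m * t ^ (T₁.level x.1 - l)) ∧
      (T₁.parent p.1 = x.1 → T₂.parent x.2 = p.2 → (NBset T₁ T₂ m p x l).Finite ∧
        ((NBset T₁ T₂ m p x l).ncard : ℝ) ≤ K * hD * lam ^ m * t ^ (T₁.level x.1 - l)) := by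
  classical
  induction m with
  | zero =>
    intro p x
    have hsub : NBset T₁ T₂ 0 p x l ⊆ {fun _ => x} := by
      rintro w ⟨h0, -⟩
      simp only [Set.mem_singleton_iff]
      funext i
      have hi : i = 0 := Fin.ext (by simp)
      rw [hi, h0]
    have hfin : (NBset T₁ T₂ 0 p x l).Finite := (Set.finite_singleton _).subset hsub
    have key : ∀ h : ℝ, 1 ≤ K * h →
        ((NBset T₁ T₂ 0 p x l).ncard : ℝ) ≤ K * h * lam ^ 0 * t ^ (T₁.level x.1 - l) := by
      intro h hh
      by_cases hl : T₁.level x.1 = l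
      · have : (NBset T₁ T₂ 0 p x l).ncard ≤ 1 := by
          simpa using Set.ncard_le_ncard hsub (Set.finite_singleton _)
        have : ((NBset T₁ T₂ 0 p x l).ncard : ℝ) ≤ 1 := by exact_mod_cast this
        simp [hl]; linarith
      · have : NBset T₁ T₂ 0 p x l = ∅ := by
          ext w
          simp only [Set.mem_empty_iff_false, iff_false]
          rintro ⟨h0, h1, -⟩
          apply hl
          rw [← h0]; exact h1
        rw [this]
        have : 0 ≤ K * h := by linarith
        simp only [Set.ncard_empty, Nat.cast_zero]
        positivity
    exact ⟨fun _ _ => ⟨hfin, key _ hKU⟩, fun _ _ => ⟨hfin, key _ hKD⟩⟩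
  | succ m ih =>
    intro p x
    obtain ⟨A, hAc, hA⟩ := fiber_finset T₁.parent α hα hreg₁ x.1
    obtain ⟨B, hBc, hB⟩ := fiber_finset T₂.parent β hβ hreg₂ x.2
    set s := t ^ (T₁.level x.1 - l) with hs
    have hu : ∀ a ∈ A, (NBset T₁ T₂ m x (a, T₂.parent x.2) l).Finite ∧
      ((NBset T₁ T₂ m x (a, T₂.parent x.2) l).ncard : ℝ) ≤ K * hU * lam ^ m * (s * t) := by
      intro a ha
      have ha' := (hA a).1 ha
      have := (ih x (a, T₂.parent x.2)).1 ha' rfl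
      have hlev := T₁.level_parent a
      rw [ha'] at hlev
      have e : T₁.level a - l = T₁.level x.1 - l + 1 := by omega
      simp only [e] at this
      rwa [zpow_add_one₀ ht.ne'] at this
    have hd : ∀ b ∈ B, (NBset T₁ T₂ m x (T₁.parent x.1, b) l).Finite ∧
      ((NBset T₁ T₂ m x (T₁.parent x.1, b) l).ncard : ℝ) ≤ K * hD * lam ^ m * (s * t⁻¹) := by
      intro b hb
      have hb' := (hB b).1 hb
      have := (ih x (T₁.parent x.1, b)).2 rfl hb'
      have e : T₁.level (T₁.parent x.1) - l = T₁.level x.1 - l - 1 := by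
        rw [T₁.level_parent]; omega
      simp only [e] at this
      rwa [zpow_sub_one₀ ht.ne'] at this
    constructor
    · intro q1 q2
      have hc : ((B.erase p.2).card : ℝ) = β - 1 := by
        rw [Finset.card_erase_of_mem ((hB _).2 q2), hBc, Nat.cast_sub (by omega)]; simp
      obtain ⟨r1, r2⟩ := NBset_step_card T₁ T₂ m p x l A (B.erase p.2)
        (fun a h _ => (hA a).2 h)
        (fun b h h' => Finset.mem_erase.2 ⟨fun hb => h' (by rw [q1, hb]), (hB b).2 h⟩) _ _
        hu (fun b hb => hd b (Finset.mem_of_mem_erase hb))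
      refine ⟨r1, r2.trans (le_of_eq ?_)⟩
      rw [hc, hAc]
      calc _ = K * lam ^ m * s * (α * t * hU + (β - 1) / t * hD) := by ring
        _ = _ := by rw [← e1]; ring
    · intro q1 q2
      have hc : ((A.erase p.1).card : ℝ) = α - 1 := by
        rw [Finset.card_erase_of_mem ((hA _).2 q1), hAc, Nat.cast_sub (by omega)]; simp
      obtain ⟨r1, r2⟩ := NBset_step_card T₁ T₂ m p x l (A.erase p.1) B
        (fun a h h' => Finset.mem_erase.2 ⟨fun hb => h' (by rw [q2, hb]), (hA a).2 h⟩)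
        (fun b h _ => (hB b).2 h) _ _
        (fun b hb => hu b (Finset.mem_of_mem_erase hb)) hd
      refine ⟨r1, r2.trans (le_of_eq ?_)⟩
      rw [hc, hBc]
      calc _ = K * lam ^ m * s * ((α - 1) * t * hU + β / t * hD) := by ring
        _ = _ := by rw [← e2]; ring

/-- The set counted by `nbCount`. -/
def NBall {V₁ V₂ : Type*} (T₁ : OrientedTree V₁) (T₂ : OrientedTree V₂)
    (o : V₁ × V₂) (n : ℕ) : Set (Fin (2 * n + 1) → V₁ × V₂) :=
  {w | w 0 = o ∧ T₁.level (w (Fin.last (2 * n))).1 = T₁.level o.1 ∧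
    (∀ i : Fin (2 * n), DLAdj T₁ T₂ (w i.castSucc) (w i.succ)) ∧
    (∀ i j : Fin (2 * n + 1), (i : ℕ) + 2 = (j : ℕ) → w i ≠ w j)}

lemma NBall_bound {V₁ V₂ : Type*}
    (T₁ : OrientedTree V₁) (T₂ : OrientedTree V₂) (α β : ℕ)
    (hα : 2 ≤ α) (hβ : 2 ≤ β)
    (hreg₁ : ∀ v : V₁, Nat.card {w : V₁ // T₁.parent w = v} = α)
    (hreg₂ : ∀ v : V₂, Nat.card {w : V₂ // T₂.parent w = v} = β)
    (o : V₁ × V₂) :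
    ∃ C : ℝ, 0 < C ∧ ∀ n : ℕ, (NBall T₁ T₂ o n).Finite ∧
      ((NBall T₁ T₂ o n).ncard : ℝ) ≤ C *
        (Real.sqrt ((α : ℝ) * β) +
          Real.sqrt (((α : ℝ) - 1) * ((β : ℝ) - 1))) ^ (2 * n) := by
  have hα' : (2 : ℝ) ≤ α := by exact_mod_cast hα
  have hβ' : (2 : ℝ) ≤ β := by exact_mod_cast hβ
  obtain ⟨a, ha0, ha⟩ : ∃ a : ℝ, 0 < a ∧ a ^ 2 = α :=
    ⟨√α, Real.sqrt_pos.2 (by linarith), Real.sq_sqrt (by linarith)⟩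
  obtain ⟨b, hb0, hb⟩ : ∃ a : ℝ, 0 < a ∧ a ^ 2 = β :=
    ⟨√β, Real.sqrt_pos.2 (by linarith), Real.sq_sqrt (by linarith)⟩
  obtain ⟨c, hc0, hc⟩ : ∃ a : ℝ, 0 < a ∧ a ^ 2 = (α : ℝ) - 1 :=
    ⟨√((α : ℝ) - 1), Real.sqrt_pos.2 (by linarith), Real.sq_sqrt (by linarith)⟩
  obtain ⟨d, hd0, hd⟩ : ∃ a : ℝ, 0 < a ∧ a ^ 2 = (β : ℝ) - 1 :=
    ⟨√((β : ℝ) - 1), Real.sqrt_pos.2 (by linarith), Real.sq_sqrt (by linarith)⟩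
  have hl1 : Real.sqrt ((α : ℝ) * β) = a * b := by
    rw [← ha, ← hb, ← mul_pow, Real.sqrt_sq (by positivity)]
  have hl2 : Real.sqrt (((α : ℝ) - 1) * ((β : ℝ) - 1)) = c * d := by
    rw [← hc, ← hd, ← mul_pow, Real.sqrt_sq (by positivity)]
  rw [hl1, hl2]
  have hDpos : 0 < b / a * c := by positivity
  have main := NBset_bound T₁ T₂ α β hα hβ hreg₁ hreg₂ (b / a) (a * b + c * d) d (b / a * c)
    (1 / d + 1 / (b / a * c)) (by positivity) (by positivity) (by positivity)
    (by
      rw [add_mul, one_div_mul_cancel hd0.ne']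
      have : 0 ≤ 1 / (b / a * c) * d := by positivity
      linarith)
    (by
      rw [add_mul, one_div_mul_cancel hDpos.ne']
      have : 0 ≤ 1 / d * (b / a * c) := by positivity
      linarith)
    (by rw [← ha, ← hd]; field_simp)
    (by rw [← hb, ← hc]; field_simp; ring) (T₁.level o.1)
  obtain ⟨B, hBc, hB⟩ := fiber_finset T₂.parent β hβ hreg₂ o.2
  obtain ⟨x, hx, y, hy, hxy⟩ := Finset.one_lt_card.1 (show 1 < B.card by omega)
  set K := 1 / d + 1 / (b / a * c)
  refine ⟨2 * (K * d), by positivity, fun n => ?_⟩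
  obtain ⟨f1, g1⟩ := (main (2 * n) (T₁.parent o.1, x) o).1 rfl ((hB x).1 hx)
  obtain ⟨f2, g2⟩ := (main (2 * n) (T₁.parent o.1, y) o).1 rfl ((hB y).1 hy)
  have hsub : NBall T₁ T₂ o n ⊆ NBset T₁ T₂ (2 * n) (T₁.parent o.1, x) o (T₁.level o.1) ∪
      NBset T₁ T₂ (2 * n) (T₁.parent o.1, y) o (T₁.level o.1) := by
    rintro w ⟨h0, h1, h2, h3⟩
    by_cases h : ∃ i : Fin (2 * n + 1), (i : ℕ) = 1 ∧ w i = (T₁.parent o.1, x)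
    · right
      refine ⟨h0, h1, h2, h3, ?_⟩
      obtain ⟨i, hi, hw⟩ := h
      intro j hj
      have : j = i := Fin.ext (by omega)
      rw [this, hw]
      intro he
      exact hxy (congrArg Prod.snd he)
    · left
      exact ⟨h0, h1, h2, h3, fun i hi hw => h ⟨i, hi, hw⟩⟩
  refine ⟨(f1.union f2).subset hsub, ?_⟩
  have k1 := (Set.ncard_le_ncard hsub (f1.union f2)).trans (Set.ncard_union_le _ _)
  have k2 : ((NBall T₁ T₂ o n).ncard : ℝ) ≤ _ := Nat.cast_le.mpr k1
  push_cast at k2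
  simp only [sub_self, zpow_zero, mul_one] at g1 g2
  linarith

lemma loop_le {V₁ V₂ : Type*}
    (T₁ : OrientedTree V₁) (T₂ : OrientedTree V₂) (o : V₁ × V₂) (n : ℕ) (hn : 2 ≤ n)
    (hf : (NBall T₁ T₂ o n).Finite) :
    loopCount T₁ T₂ o (2 * n) ≤ (NBall T₁ T₂ o n).ncard := by
  have : loopCount T₁ T₂ o (2 * n) = Set.ncard {w : Fin (2 * n + 1) → V₁ × V₂ |
    w 0 = o ∧ w (Fin.last (2 * n)) = o ∧
    (∀ i : Fin (2 * n), DLAdj T₁ T₂ (w i.castSucc) (w i.succ)) ∧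
    (∀ i j : Fin (2 * n), w i.castSucc = w j.castSucc → i = j)} := rfl
  rw [this]
  apply Set.ncard_le_ncard _ hf
  rintro w ⟨h0, h1, h2, h3⟩
  refine ⟨h0, by rw [h1], h2, ?_⟩
  intro i j hij he
  have hi : (i : ℕ) < 2 * n := by omega
  by_cases hj : (j : ℕ) < 2 * n
  · have := h3 ⟨i, hi⟩ ⟨j, hj⟩ he
    have := congrArg Fin.val this
    simp only at this
    omega
  · have hj' : j = Fin.last (2 * n) := Fin.ext (by simp; omega)
    have := h3 ⟨i, hi⟩ ⟨0, by omega⟩ (by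
      change w i = w 0
      rw [he, hj', h1, h0])
    have := congrArg Fin.val this
    simp only at this
    omega

/-- In `Γ_{α,β}`, the number of non-backtracking paths of length `2n` from a fixed vertex
making `n` upward and `n` downward steps is at most
`C·n·(√(αβ)+√((α−1)(β−1)))^{2n}`; consequently the exponential growth rate of the number
`a_{2n}` of simple loops of length `2n` through a fixed vertex is at most
`√(αβ)+√((α−1)(β−1))`. -/
theorem DL_loop_growth {V₁ V₂ : Type*}
    (T₁ : OrientedTree V₁) (T₂ : OrientedTree V₂) (α β : ℕ)
    (hα : 2 ≤ α) (hβ : 2 ≤ β)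
    (hreg₁ : ∀ v : V₁, Nat.card {w : V₁ // T₁.parent w = v} = α)
    (hreg₂ : ∀ v : V₂, Nat.card {w : V₂ // T₂.parent w = v} = β)
    (o : V₁ × V₂) :
    (∃ C : ℝ, 0 < C ∧ ∀ n : ℕ, 1 ≤ n →
      (nbCount T₁ T₂ o n : ℝ) ≤ C * n *
        (Real.sqrt ((α : ℝ) * β) +
          Real.sqrt (((α : ℝ) - 1) * ((β : ℝ) - 1))) ^ (2 * n)) ∧
    limsup (fun n : ℕ => (loopCount T₁ T₂ o (2 * n) : ℝ) ^ (1 / (2 * n : ℝ))) atTop ≤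
      Real.sqrt ((α : ℝ) * β) + Real.sqrt (((α : ℝ) - 1) * ((β : ℝ) - 1)) := by
  obtain ⟨C, hC, h⟩ := NBall_bound T₁ T₂ α β hα hβ hreg₁ hreg₂ o
  set lam := Real.sqrt ((α : ℝ) * β) + Real.sqrt (((α : ℝ) - 1) * ((β : ℝ) - 1)) with hlam
  have hl0 : 0 ≤ lam := by positivity
  refine ⟨⟨C, hC, fun n hn => ?_⟩, ?_⟩
  · have h1 : (nbCount T₁ T₂ o n : ℝ) ≤ C * lam ^ (2 * n) := (h n).2
    have hn' : (1 : ℝ) ≤ n := by exact_mod_cast hn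
    have h2 : 0 ≤ C * lam ^ (2 * n) := by positivity
    nlinarith
  · have hT : Tendsto (fun n : ℕ => C ^ (1 / (2 * n : ℝ)) * lam) atTop (nhds lam) := by
      have h1 : Tendsto (fun n : ℕ => (1 / (2 * n : ℝ))) atTop (nhds 0) := by
        have := (tendsto_one_div_atTop_nhds_zero_nat (𝕜 := ℝ)).const_mul (1 / 2)
        simp only [mul_zero] at this
        refine this.congr fun n => ?_
        rw [one_div_mul_one_div]
      have h2 := ((tendsto_const_nhds (x := C)).rpow h1 (Or.inl hC.ne')).mul_const lam
      simpa using h2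
    rw [← hT.limsup_eq]
    refine limsup_le_limsup ?_ ?_ hT.isBoundedUnder_le
    · filter_upwards [eventually_ge_atTop 2] with n hn
      have h1 : (loopCount T₁ T₂ o (2 * n) : ℝ) ≤ C * lam ^ (2 * n) :=
        le_trans (Nat.cast_le.2 (loop_le T₁ T₂ o n hn (h n).1)) (h n).2
      have hn0 : 2 * n ≠ 0 := by omega
      calc _ ≤ (C * lam ^ (2 * n)) ^ (1 / (2 * n : ℝ)) :=
            Real.rpow_le_rpow (by positivity) h1 (by positivity)
        _ = C ^ (1 / (2 * n : ℝ)) * lam := by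
            rw [Real.mul_rpow hC.le (by positivity)]
            congr 1
            have := Real.pow_rpow_inv_natCast hl0 hn0
            push_cast at this
            rwa [one_div]
    · exact IsBoundedUnder.isCoboundedUnder_le ⟨0, eventually_map.2
        (Eventually.of_forall fun n => Real.rpow_nonneg (Nat.cast_nonneg _) _)⟩
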